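/- arXiv:1503.01616 — 3 statements merged into one kernel-verified Lean document; each statement's English description precedes it below -/
import Mathlib

section
/- Multiplicativity of the generalized exponential: for every real parameter p and all α, β ∈ ℝ, M^p((cosp α, sinp α), (cosp β, sinp β)) = (cosp(α + β), sinp(α + β)); i.e. e^{iα}·e^{iβ} = e^{i(α+β)} in the generalized complex plane C_p. -/
noncomputable def cosp (p θ : ℝ) : ℝ :=
  if p < 0 then Real.cos (θ * Real.sqrt (-p))
  else if p = 0 then 1
  else Real.cosh (θ * Real.sqrt p)

noncomputable def sinp (p θ : ℝ) : ℝ :=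
  if p < 0 then Real.sin (θ * Real.sqrt (-p)) / Real.sqrt (-p)
  else if p = 0 then θ
  else Real.sinh (θ * Real.sqrt p) / Real.sqrt p

/-- The generalized product `M^p` on `C_p ≅ ℝ²`. -/
def Mp (p : ℝ) (z₁ z₂ : ℝ × ℝ) : ℝ × ℝ :=
  (z₁.1 * z₂.1 + p * z₁.2 * z₂.2, z₁.1 * z₂.2 + z₂.1 * z₁.2)

theorem exp_mul_exp (p α β : ℝ) :
    Mp p (cosp p α, sinp p α) (cosp p β, sinp p β) =
      (cosp p (α + β), sinp p (α + β)) := by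
  rcases lt_trichotomy p 0 with h | h | h
  · have hs : 0 < Real.sqrt (-p) := Real.sqrt_pos.mpr (by linarith)
    have hq : p = -(Real.sqrt (-p) ^ 2) := by
      rw [Real.sq_sqrt (by linarith)]; ring
    simp only [Mp, cosp, sinp, if_pos h, add_mul, Real.cos_add, Real.sin_add]
    generalize Real.sqrt (-p) = s at hs hq
    subst hq
    refine Prod.ext ?_ ?_
    · simp only
      field_simp
      ring
    · simp only
      field_simp
      ring
  · subst h
    simp [Mp, cosp, sinp, add_comm]
  · have hs : 0 < Real.sqrt p := Real.sqrt_pos.mpr h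
    have hq : p = Real.sqrt p ^ 2 := (Real.sq_sqrt h.le).symm
    simp only [Mp, cosp, sinp, if_neg h.not_gt, if_neg h.ne', add_mul, Real.cosh_add,
      Real.sinh_add]
    generalize Real.sqrt p = s at hs hq
    subst hq
    refine Prod.ext ?_ ?_
    · simp only
      field_simp
    · simp only
      field_simp
      ring
end

section
/- Generalized Bobillier formula (geometric form): let p ∈ ℝ, θ₁, θ₂, θ₃ ∈ ℝ and ρ₁*, ρ₂*, ρ₃* be nonzero real numbers, and set X_k = (cosp θ_k, sinp θ_k) for k = 1, 2, 3. If the three points Q_k = (1/ρ_k*)·X_k in ℝ² are collinear, then ρ₁*·sinp(θ₃ − θ₂) + ρ₂*·sinp(θ₁ − θ₃) + ρ₃*·sinp(θ₂ − θ₁) = 0. -/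
theorem sinp_sub_aux (p a b : ℝ) :
    sinp p (a - b) = sinp p a * cosp p b - cosp p a * sinp p b := by
  unfold sinp cosp
  split_ifs with h1 h2
  · rw [sub_mul, Real.sin_sub]; ring
  · ring
  · rw [sub_mul, Real.sinh_sub]; ring

theorem generalized_bobillier_geometric (p θ₁ θ₂ θ₃ ρ₁ ρ₂ ρ₃ : ℝ)
    (hρ₁ : ρ₁ ≠ 0) (hρ₂ : ρ₂ ≠ 0) (hρ₃ : ρ₃ ≠ 0)
    (hcol : Collinear ℝ
      ({(1 / ρ₁) • ((cosp p θ₁, sinp p θ₁) : ℝ × ℝ),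
        (1 / ρ₂) • ((cosp p θ₂, sinp p θ₂) : ℝ × ℝ),
        (1 / ρ₃) • ((cosp p θ₃, sinp p θ₃) : ℝ × ℝ)} : Set (ℝ × ℝ))) :
    ρ₁ * sinp p (θ₃ - θ₂) + ρ₂ * sinp p (θ₁ - θ₃) + ρ₃ * sinp p (θ₂ - θ₁) = 0 := by
  rw [collinear_iff_of_mem (p₀ := (1 / ρ₁) • ((cosp p θ₁, sinp p θ₁) : ℝ × ℝ)) (by simp)] at hcol
  obtain ⟨v, hv⟩ := hcol
  obtain ⟨r, hr⟩ := hv ((1 / ρ₂) • ((cosp p θ₂, sinp p θ₂) : ℝ × ℝ)) (by simp)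
  obtain ⟨s, hs⟩ := hv ((1 / ρ₃) • ((cosp p θ₃, sinp p θ₃) : ℝ × ℝ)) (by simp)
  rw [Prod.ext_iff] at hr hs
  obtain ⟨hr1, hr2⟩ := hr
  obtain ⟨hs1, hs2⟩ := hs
  simp only [Prod.smul_mk, smul_eq_mul, vadd_eq_add, Prod.fst_add, Prod.snd_add,
    Prod.smul_fst, Prod.smul_snd] at hr1 hr2 hs1 hs2
  rw [sinp_sub_aux, sinp_sub_aux, sinp_sub_aux]
  generalize cosp p θ₁ = c₁ at *
  generalize cosp p θ₂ = c₂ at *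
  generalize cosp p θ₃ = c₃ at *
  generalize sinp p θ₁ = s₁ at *
  generalize sinp p θ₂ = s₂ at *
  generalize sinp p θ₃ = s₃ at *
  have e2 : c₂ = ρ₂ * (r * v.1 + 1 / ρ₁ * c₁) := by rw [← hr1]; field_simp
  have f2 : s₂ = ρ₂ * (r * v.2 + 1 / ρ₁ * s₁) := by rw [← hr2]; field_simp
  have e3 : c₃ = ρ₃ * (s * v.1 + 1 / ρ₁ * c₁) := by rw [← hs1]; field_simp
  have f3 : s₃ = ρ₃ * (s * v.2 + 1 / ρ₁ * s₁) := by rw [← hs2]; field_simp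
  rw [e2, f2, e3, f3]
  field_simp
  ring
end

section
/- Generalized Bobillier formula (kinematic form, without the Euler–Savary formula): let p ∈ ℝ, θ₁, θ₂, θ₃ ∈ ℝ, w ∈ ℝ with w ≠ 0, and J ∈ ℝ². Set X_k = (cosp θ_k, sinp θ_k) and ρ_k* = −⟨J, X_k⟩_p / w² for k = 1, 2, 3. Then ρ₁*·sinp(θ₃ − θ₂) + ρ₂*·sinp(θ₁ − θ₃) + ρ₃*·sinp(θ₂ − θ₁) = 0. -/
/-- The p-scalar product on `C_p ≅ ℝ²`. -/
def pInner (p : ℝ) (z₁ z₂ : ℝ × ℝ) : ℝ :=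
  z₁.1 * z₂.1 - p * z₁.2 * z₂.2

theorem generalized_bobillier_kinematic (p θ₁ θ₂ θ₃ w : ℝ) (hw : w ≠ 0)
    (J : ℝ × ℝ) :
    (-(pInner p J (cosp p θ₁, sinp p θ₁)) / w ^ 2) * sinp p (θ₃ - θ₂) +
      (-(pInner p J (cosp p θ₂, sinp p θ₂)) / w ^ 2) * sinp p (θ₁ - θ₃) +
      (-(pInner p J (cosp p θ₃, sinp p θ₃)) / w ^ 2) * sinp p (θ₂ - θ₁) = 0 := by
  simp only [sinp_sub_aux, pInner]
  ring
end
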